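/- Fix ε > 0 with cl(B(a,ε)) ⊂ Ω and set Ω_ε = Ω ∖ cl(B(a,ε)). For every open set V ⊂ ℝⁿ containing cl(Ω_ε) there exists η > 0 such that every nonzero u ∈ C_c^∞(Ω_ε) with Γ(u) = 0 and E(u) ≤ (1/n)(p₀S)^{n/2} + 2η satisfies F(u) ∈ V. -/

import Mathlib

open MeasureTheory Filter Asymptotics
open scoped Topology

noncomputable section

/-- Euclidean space `ℝⁿ`. -/
abbrev Euc (n : ℕ) := EuclideanSpace ℝ (Fin n)

/-- `u ∈ C_c^∞(Ω)`, `u ≢ 0`. -/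
def IsTest {n : ℕ} (Ω : Set (Euc n)) (u : Euc n → ℝ) : Prop :=
  ContDiff ℝ (⊤ : ℕ∞) u ∧ HasCompactSupport u ∧ tsupport u ⊆ Ω ∧ u ≠ 0

/-- The best Sobolev constant
`S = inf { ∫_Ω |∇u|² / (∫_Ω |u|^q)^{2/q} : u ∈ C_c^∞(Ω), u ≢ 0 }`. -/
def SobolevS {n : ℕ} (Ω : Set (Euc n)) (q : ℝ) : ℝ :=
  sInf {r : ℝ | ∃ u : Euc n → ℝ, IsTest Ω u ∧
    r = (∫ x in Ω, ‖gradient u x‖ ^ 2) / (∫ x in Ω, |u x| ^ q) ^ (2 / q)}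

lemma norm_gradient_eq {n : ℕ} (u : Euc n → ℝ) (x : Euc n) :
    ‖gradient u x‖ = ‖fderiv ℝ u x‖ := by
  rw [← toDual_gradient, LinearIsometryEquiv.norm_map]

lemma hasCompactSupport_abs_rpow {n : ℕ} {u : Euc n → ℝ} (hs : HasCompactSupport u) {r : ℝ}
    (hr : 0 < r) : HasCompactSupport fun x => |u x| ^ r :=
  hs.comp_left (g := fun t : ℝ => |t| ^ r) (by simp [hr.ne'])

lemma continuous_abs_rpow {n : ℕ} {u : Euc n → ℝ} (hu : Continuous u) {r : ℝ}
    (hr : 0 < r) : Continuous fun x => |u x| ^ r :=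
  hu.abs.rpow_const fun _ => Or.inr hr.le

lemma integrable_abs_rpow {n : ℕ} {u : Euc n → ℝ} (hu : Continuous u)
    (hs : HasCompactSupport u) {r : ℝ} (hr : 0 < r) : Integrable fun x => |u x| ^ r :=
  (continuous_abs_rpow hu hr).integrable_of_hasCompactSupport (hasCompactSupport_abs_rpow hs hr)

lemma integral_abs_rpow_pos {n : ℕ} {u : Euc n → ℝ} (hu : Continuous u)
    (hs : HasCompactSupport u) (h0 : u ≠ 0) {r : ℝ} (hr : 0 < r) : 0 < ∫ x, |u x| ^ r := by
  obtain ⟨x, hx⟩ := Function.ne_iff.1 h0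
  refine (continuous_abs_rpow hu hr).integral_pos_of_hasCompactSupport_nonneg_nonzero
    (hasCompactSupport_abs_rpow hs hr) (fun x => by positivity) (x := x) ?_
  have : 0 < |u x| := abs_pos.2 hx
  positivity

lemma continuous_norm_fderiv_sq {n : ℕ} {u : Euc n → ℝ} (hu : ContDiff ℝ (⊤ : ℕ∞) u) :
    Continuous fun x => ‖fderiv ℝ u x‖ ^ 2 :=
  (hu.continuous_fderiv (by simp)).norm.pow 2

lemma hasCompactSupport_norm_fderiv_sq {n : ℕ} {u : Euc n → ℝ} (hs : HasCompactSupport u) :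
    HasCompactSupport fun x => ‖fderiv ℝ u x‖ ^ 2 :=
  (hs.fderiv ℝ).comp_left (g := fun t => ‖t‖ ^ 2) (by simp)

lemma integrable_norm_fderiv_sq {n : ℕ} {u : Euc n → ℝ} (hu : ContDiff ℝ (⊤ : ℕ∞) u)
    (hs : HasCompactSupport u) : Integrable fun x => ‖fderiv ℝ u x‖ ^ 2 :=
  (continuous_norm_fderiv_sq hu).integrable_of_hasCompactSupport
    (hasCompactSupport_norm_fderiv_sq hs)

lemma fderiv_eq_zero_of_notMem_tsupport {n : ℕ} {u : Euc n → ℝ} {x : Euc n}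
    (hx : x ∉ tsupport u) : fderiv ℝ u x = 0 :=
  image_eq_zero_of_notMem_tsupport (fun h => hx (tsupport_fderiv_subset ℝ h))

lemma setIntegral_abs_rpow {n : ℕ} {Ω : Set (Euc n)} {u : Euc n → ℝ} (hΩ : tsupport u ⊆ Ω)
    {r : ℝ} (hr : 0 < r) : ∫ x in Ω, |u x| ^ r = ∫ x, |u x| ^ r :=
  setIntegral_eq_integral_of_forall_compl_eq_zero fun x hx => by
    simp [image_eq_zero_of_notMem_tsupport fun h => hx (hΩ h), hr.ne']

lemma setIntegral_norm_gradient_sq {n : ℕ} {Ω : Set (Euc n)} {u : Euc n → ℝ}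
    (hΩ : tsupport u ⊆ Ω) : ∫ x in Ω, ‖gradient u x‖ ^ 2 = ∫ x, ‖fderiv ℝ u x‖ ^ 2 := by
  simp_rw [norm_gradient_eq]
  exact setIntegral_eq_integral_of_forall_compl_eq_zero fun x hx => by
    simp [fderiv_eq_zero_of_notMem_tsupport fun h => hx (hΩ h)]

lemma sobolevS_mul_le {n : ℕ} {Ω : Set (Euc n)} {q : ℝ} (hq : 0 < q) {u : Euc n → ℝ}
    (hu : ContDiff ℝ (⊤ : ℕ∞) u) (hs : HasCompactSupport u) (hΩ : tsupport u ⊆ Ω) :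
    SobolevS Ω q * (∫ x, |u x| ^ q) ^ (2 / q) ≤ ∫ x, ‖fderiv ℝ u x‖ ^ 2 := by
  by_cases h0 : u = 0
  · have : (0 : ℝ) ^ (2 / q) = 0 := Real.zero_rpow (by positivity)
    simp [h0, hq.ne', this]
  have hpos : 0 < (∫ x, |u x| ^ q) ^ (2 / q) :=
    Real.rpow_pos_of_pos (integral_abs_rpow_pos hu.continuous hs h0 hq) _
  rw [← le_div_iff₀ hpos]
  refine csInf_le ⟨0, ?_⟩ ⟨u, ⟨hu, hs, hΩ, h0⟩, ?_⟩
  · rintro _ ⟨v, -, rfl⟩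
    have h1 : 0 ≤ ∫ x in Ω, ‖gradient v x‖ ^ 2 := integral_nonneg fun x => by positivity
    have h2 : 0 ≤ ∫ x in Ω, |v x| ^ q := integral_nonneg fun x => by positivity
    positivity
  · rw [setIntegral_abs_rpow hΩ hq, setIntegral_norm_gradient_sq hΩ]

lemma exists_sobolev_const {n : ℕ} (hn : 3 ≤ n) {q : ℝ} (hq : q = 2 * (n : ℝ) / ((n : ℝ) - 2)) :
    ∃ c : ℝ, 0 < c ∧ ∀ u : Euc n → ℝ, ContDiff ℝ (⊤ : ℕ∞) u → HasCompactSupport u →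
      c * (∫ x, |u x| ^ q) ^ (2 / q) ≤ ∫ x, ‖fderiv ℝ u x‖ ^ 2 := by
  have hn' : (3 : ℝ) ≤ n := by exact_mod_cast hn
  have hn2 : (0 : ℝ) < n - 2 := by linarith
  have hq0 : 0 < q := by rw [hq]; positivity
  set C := eLpNormLESNormFDerivOfEqInnerConst (volume : Measure (Euc n)) ((2 : NNReal) : ℝ) with hC
  obtain ⟨q', hq'⟩ : ∃ q' : NNReal, (q' : ℝ) = q := ⟨⟨q, hq0.le⟩, rfl⟩
  have hq0' : (q' : ENNReal) ≠ 0 := by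
    rw [ENNReal.coe_ne_zero, ← NNReal.coe_ne_zero, hq']
    exact hq0.ne'
  refine ⟨((C : ℝ) ^ 2 + 1)⁻¹, by positivity, fun u hu hs => ?_⟩
  have key := eLpNorm_le_eLpNorm_fderiv_of_eq_inner (volume : Measure (Euc n))
    (hu.of_le (by simp)) hs (p := 2) (p' := q') (by norm_num)
    (by rw [finrank_euclideanSpace_fin]; omega)
    (by rw [finrank_euclideanSpace_fin]; rw [hq', hq]; push_cast; field_simp)
  have m1 : MemLp u (q' : ENNReal) :=
    hu.continuous.memLp_of_hasCompactSupport hs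
  have m2 : MemLp (fderiv ℝ u) ((2 : NNReal) : ENNReal) :=
    (hu.continuous_fderiv (by simp)).memLp_of_hasCompactSupport (hs.fderiv ℝ)
  rw [m1.eLpNorm_eq_integral_rpow_norm hq0' (by simp),
    m2.eLpNorm_eq_integral_rpow_norm (by simp) (by simp), ← hC,
    ← ENNReal.ofReal_coe_nnreal (p := C), ← ENNReal.ofReal_mul (by positivity),
    ENNReal.ofReal_le_ofReal_iff (by positivity)] at key
  simp only [ENNReal.coe_toReal, hq', Real.norm_eq_abs, NNReal.coe_ofNat,
    Real.rpow_two] at key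
  have hI : 0 ≤ ∫ x, |u x| ^ q := integral_nonneg fun x => by positivity
  have hJ : 0 ≤ ∫ x, ‖fderiv ℝ u x‖ ^ 2 := integral_nonneg fun x => by positivity
  have h2 := pow_le_pow_left₀ (by positivity) key 2
  rw [mul_pow, ← Real.rpow_natCast, ← Real.rpow_mul hI,
    ← Real.rpow_natCast (_ ^ (2 : ℝ)⁻¹), ← Real.rpow_mul hJ] at h2
  rw [show q⁻¹ * ((2 : ℕ) : ℝ) = 2 / q by push_cast; field_simp] at h2
  norm_num at h2
  rw [inv_mul_le_iff₀ (by positivity)]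
  nlinarith

lemma exists_isTest {n : ℕ} {Ω : Set (Euc n)} (hΩ : IsOpen Ω) {a : Euc n} (ha : a ∈ Ω) :
    ∃ u, IsTest Ω u := by
  obtain ⟨f, h1, h2, h3, -, h5⟩ := exists_contDiff_tsupport_subset (n := ⊤) (hΩ.mem_nhds ha)
  exact ⟨f, h3, h2, h1, fun h => by simp [h] at h5⟩

lemma sobolevS_pos {n : ℕ} (hn : 3 ≤ n) {q : ℝ} (hq : q = 2 * (n : ℝ) / ((n : ℝ) - 2))
    {Ω : Set (Euc n)} (hΩ : IsOpen Ω) {a : Euc n} (ha : a ∈ Ω) : 0 < SobolevS Ω q := by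
  have hn' : (3 : ℝ) ≤ n := by exact_mod_cast hn
  have hn2 : (0 : ℝ) < n - 2 := by linarith
  have hq0 : 0 < q := by rw [hq]; positivity
  obtain ⟨c, hc, h⟩ := exists_sobolev_const hn hq
  obtain ⟨v, hv⟩ := exists_isTest hΩ ha
  refine hc.trans_le (le_csInf ⟨_, v, hv, rfl⟩ ?_)
  rintro _ ⟨u, ⟨hu, hs, hΩ, h0⟩, rfl⟩
  have hpos : 0 < (∫ x, |u x| ^ q) ^ (2 / q) :=
    Real.rpow_pos_of_pos (integral_abs_rpow_pos hu.continuous hs h0 hq0) _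
  rw [setIntegral_abs_rpow hΩ hq0, setIntegral_norm_gradient_sq hΩ, le_div_iff₀ hpos]
  exact h u hu hs

lemma sobolevS_mul_le_of_hasCompactSupport {n : ℕ} (hn : 3 ≤ n) {q : ℝ}
    (hq : q = 2 * (n : ℝ) / ((n : ℝ) - 2))
    {Ω : Set (Euc n)} (hΩ : IsOpen Ω) {a : Euc n} (ha : a ∈ Ω) {u : Euc n → ℝ}
    (hu : ContDiff ℝ (⊤ : ℕ∞) u) (hs : HasCompactSupport u) :
    SobolevS Ω q * (∫ x, |u x| ^ q) ^ (2 / q) ≤ ∫ x, ‖fderiv ℝ u x‖ ^ 2 := by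
  have hn' : (3 : ℝ) ≤ n := by exact_mod_cast hn
  have hn2 : (0 : ℝ) < n - 2 := by linarith
  have hq0 : 0 < q := by rw [hq]; positivity
  obtain ⟨r, hr, hrΩ⟩ := Metric.isOpen_iff.1 hΩ a ha
  obtain ⟨R, hR, hRs⟩ := hs.isBounded.exists_pos_norm_le
  set l : ℝ := (R + 1) / r with hl
  have hl0 : 0 < l := by positivity
  set v : Euc n → ℝ := fun x => u (l • (x - a)) with hv
  have hvc : ContDiff ℝ (⊤ : ℕ∞) v := by fun_prop
  let e : Euc n ≃ₜ Euc n :=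
    (Homeomorph.subRight a).trans (Homeomorph.smulOfNeZero l hl0.ne')
  have hve : v = u ∘ e := rfl
  have hvs : HasCompactSupport v := hs.comp_homeomorph e
  have hvΩ : tsupport v ⊆ Ω := by
    intro x hx
    have hx' : l • (x - a) ∈ tsupport u := tsupport_comp_subset_preimage u e.continuous hx
    apply hrΩ
    have := hRs _ hx'
    rw [norm_smul, Real.norm_of_nonneg hl0.le] at this
    rw [Metric.mem_ball, dist_eq_norm]
    have h3 : l * r = R + 1 := by rw [hl]; field_simp
    by_contra! h4
    nlinarith
  have key := sobolevS_mul_le hq0 hvc hvs hvΩ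
  have e1 : ∫ x, |v x| ^ q = (l ^ n)⁻¹ * ∫ x, |u x| ^ q := by
    rw [hv, integral_sub_right_eq_self (fun y => |u (l • y)| ^ q) a,
      Measure.integral_comp_smul volume (fun y => |u y| ^ q) l, finrank_euclideanSpace_fin,
      abs_of_pos (by positivity), smul_eq_mul]
  have hd : ∀ x, ‖fderiv ℝ v x‖ ^ 2 = l ^ 2 * ‖fderiv ℝ u (l • (x - a))‖ ^ 2 := by
    intro x
    have h1 : HasFDerivAt (fun x : Euc n => l • (x - a)) (l • ContinuousLinearMap.id ℝ (Euc n)) x :=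
      ((hasFDerivAt_id x).sub_const a).const_smul l
    have h2 := ((hu.differentiable (by simp)) (l • (x - a))).hasFDerivAt.comp x h1
    have h3 : fderiv ℝ v x = l • fderiv ℝ u (l • (x - a)) := by
      rw [show v = u ∘ fun x => l • (x - a) from rfl, h2.fderiv]
      ext y; simp
    rw [h3, norm_smul, mul_pow, Real.norm_of_nonneg hl0.le]
  have e2 : ∫ x, ‖fderiv ℝ v x‖ ^ 2 = l ^ 2 * ((l ^ n)⁻¹ * ∫ x, ‖fderiv ℝ u x‖ ^ 2) := by
    simp_rw [hd]
    rw [integral_const_mul, integral_sub_right_eq_self (fun y => ‖fderiv ℝ u (l • y)‖ ^ 2) a,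
      Measure.integral_comp_smul volume (fun y => ‖fderiv ℝ u y‖ ^ 2) l, finrank_euclideanSpace_fin,
      abs_of_pos (by positivity), smul_eq_mul]
  have hI : 0 ≤ ∫ x, |u x| ^ q := integral_nonneg fun x => by positivity
  have hpow : ((l ^ n)⁻¹) ^ (2 / q) = l ^ 2 * (l ^ n)⁻¹ := by
    rw [Real.inv_rpow (by positivity), ← Real.rpow_natCast, ← Real.rpow_mul hl0.le,
      ← Real.rpow_neg hl0.le, ← Real.rpow_neg hl0.le, ← Real.rpow_natCast l 2,
      ← Real.rpow_add hl0]
    congr 1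
    rw [hq]; push_cast; field_simp; ring
  rw [e1, e2, Real.mul_rpow (by positivity) hI, hpow] at key
  have hk : 0 < l ^ 2 * (l ^ n)⁻¹ := by positivity
  nlinarith

/-- A Sobolev inequality with remainder, obtained by testing with `√(u² + c²) - c + 2cχ`. -/
lemma exists_sobolev_remainder {n : ℕ} {S q : ℝ} (hS : 0 ≤ S) (hq : 1 < q)
    (hSob : ∀ u : Euc n → ℝ, ContDiff ℝ (⊤ : ℕ∞) u → HasCompactSupport u →
      S * (∫ x, |u x| ^ q) ^ (2 / q) ≤ ∫ x, ‖fderiv ℝ u x‖ ^ 2)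
    {Ω : Set (Euc n)} (hΩ : Bornology.IsBounded Ω) :
    ∃ k : ℝ, 0 ≤ k ∧ ∀ u : Euc n → ℝ, ContDiff ℝ (⊤ : ℕ∞) u → HasCompactSupport u →
      tsupport u ⊆ Ω → ∀ c : ℝ, 0 < c →
      S * ((∫ x, |u x| ^ q) + c * ∫ x, |u x| ^ (q - 1)) ^ (2 / q) ≤
        (∫ x, ‖fderiv ℝ u x‖ ^ 2) + k * c ^ 2 := by
  obtain ⟨R, hR, hRΩ⟩ := hΩ.exists_pos_norm_lt
  let χ : ContDiffBump (0 : Euc n) := ⟨R, R + 1, hR, by linarith⟩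
  have hχc : ContDiff ℝ (⊤ : ℕ∞) χ := χ.contDiff
  have hχs : HasCompactSupport χ := χ.hasCompactSupport
  have hχ1 : ∀ x ∈ Ω, (χ : Euc n → ℝ) =ᶠ[𝓝 x] fun _ => 1 := by
    intro x hx
    have : Metric.ball (0 : Euc n) R ∈ 𝓝 x :=
      Metric.isOpen_ball.mem_nhds (by simpa using hRΩ x hx)
    filter_upwards [this] with y hy
    exact χ.one_of_mem_closedBall (Metric.ball_subset_closedBall hy)
  refine ⟨4 * ∫ x, ‖fderiv ℝ χ x‖ ^ 2,
    mul_nonneg (by norm_num) (integral_nonneg fun x => by positivity), ?_⟩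
  intro u hu hs hΩu c hc
  set φ : Euc n → ℝ := fun x => (√(u x ^ 2 + c ^ 2) - c) + 2 * c * χ x with hφ
  have hpos : ∀ x, 0 < u x ^ 2 + c ^ 2 := fun x => by positivity
  have hφc : ContDiff ℝ (⊤ : ℕ∞) φ :=
    ((((hu.pow 2).add contDiff_const).sqrt fun x => (hpos x).ne').sub contDiff_const).add
      (contDiff_const.mul hχc)
  have hφs : HasCompactSupport φ :=
    (hs.comp_left (g := fun t : ℝ => √(t ^ 2 + c ^ 2) - c) (by simp [Real.sqrt_sq hc.le])).add
      (hχs.comp_left (g := fun t : ℝ => 2 * c * t) (by simp))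
  have hfd : ∀ x, ‖fderiv ℝ φ x‖ ^ 2 ≤
      ‖fderiv ℝ u x‖ ^ 2 + 4 * c ^ 2 * ‖fderiv ℝ χ x‖ ^ 2 := by
    intro x
    have hux := ((hu.differentiable (by simp)) x).hasFDerivAt
    have hχx := ((hχc.differentiable (by simp)) x).hasFDerivAt
    have h1 := (((hux.pow 2).add_const (c ^ 2)).sqrt (hpos x).ne').sub_const c
    have h2 := h1.add (hχx.const_mul (2 * c))
    have h3 : fderiv ℝ φ x = (u x / √(u x ^ 2 + c ^ 2)) • fderiv ℝ u x +
        (2 * c) • fderiv ℝ χ x := by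
      refine h2.fderiv.trans ?_
      congr 1
      ext y
      have := Real.sqrt_pos.2 (hpos x)
      simp
      field_simp
    have ht : |u x / √(u x ^ 2 + c ^ 2)| ≤ 1 := by
      rw [abs_div, abs_of_nonneg (Real.sqrt_nonneg _), div_le_one (Real.sqrt_pos.2 (hpos x))]
      exact Real.abs_le_sqrt (by nlinarith)
    rw [h3]
    by_cases hx : x ∈ tsupport u
    · have : fderiv ℝ χ x = 0 := by
        rw [(hχ1 x (hΩu hx)).fderiv_eq]; simp
      rw [this]
      simp only [smul_zero, add_zero, norm_zero, norm_smul, Real.norm_eq_abs]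
      rw [mul_pow]
      have : |u x / √(u x ^ 2 + c ^ 2)| ^ 2 ≤ 1 := pow_le_one₀ (abs_nonneg _) ht
      nlinarith [sq_nonneg ‖fderiv ℝ u x‖]
    · rw [fderiv_eq_zero_of_notMem_tsupport hx]
      simp only [smul_zero, zero_add, norm_zero, norm_smul, Real.norm_eq_abs]
      rw [mul_pow, sq_abs]
      nlinarith
  have hge : ∀ x, |u x| ^ q + c * |u x| ^ (q - 1) ≤ |φ x| ^ q := by
    intro x
    by_cases hx : x ∈ Ω
    · have h1 : φ x = √(u x ^ 2 + c ^ 2) + c := by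
        simp only [hφ, (hχ1 x hx).eq_of_nhds]; ring
      have h2 : |u x| + c ≤ |φ x| := by
        rw [h1]
        exact (add_le_add_left (Real.abs_le_sqrt (by nlinarith)) c).trans (le_abs_self _)
      have h0 := abs_nonneg (u x)
      calc |u x| ^ q + c * |u x| ^ (q - 1) = |u x| ^ (q - 1) * (|u x| + c) := by
            have : |u x| ^ q = |u x| ^ (q - 1) * |u x| := by
              rw [← Real.rpow_add_one' h0 (by linarith)]; ring_nf
            rw [this]; ring
        _ ≤ (|u x| + c) ^ (q - 1) * (|u x| + c) := by gcongr; linarith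
        _ = (|u x| + c) ^ q := by
            rw [← Real.rpow_add_one' (by positivity) (by linarith)]; ring_nf
        _ ≤ _ := Real.rpow_le_rpow (by positivity) h2 (by linarith)
    · have : u x = 0 := image_eq_zero_of_notMem_tsupport fun h => hx (hΩu h)
      rw [this, abs_zero, Real.zero_rpow (by linarith), Real.zero_rpow (by linarith)]
      simp only [mul_zero, add_zero]
      positivity
  have hq0 : 0 < q := by linarith
  have iq := integrable_abs_rpow hu.continuous hs hq0
  have iq1 := integrable_abs_rpow hu.continuous hs (r := q - 1) (by linarith)
  have hI : (∫ x, |u x| ^ q) + c * ∫ x, |u x| ^ (q - 1) ≤ ∫ x, |φ x| ^ q := by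
    rw [← integral_const_mul, ← integral_add iq (iq1.const_mul c)]
    exact integral_mono (iq.add (iq1.const_mul c)) (integrable_abs_rpow hφc.continuous hφs hq0) hge
  have hJ : ∫ x, ‖fderiv ℝ φ x‖ ^ 2 ≤
      (∫ x, ‖fderiv ℝ u x‖ ^ 2) + 4 * (∫ x, ‖fderiv ℝ χ x‖ ^ 2) * c ^ 2 := by
    have i1 := integrable_norm_fderiv_sq hu hs
    have i2 := (integrable_norm_fderiv_sq hχc hχs).const_mul (4 * c ^ 2)
    rw [show 4 * (∫ x, ‖fderiv ℝ χ x‖ ^ 2) * c ^ 2 = 4 * c ^ 2 * ∫ x, ‖fderiv ℝ χ x‖ ^ 2 by ring,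
      ← integral_const_mul, ← integral_add i1 i2]
    exact integral_mono (integrable_norm_fderiv_sq hφc hφs) (i1.add i2) hfd
  have h0 : 0 ≤ (∫ x, |u x| ^ q) + c * ∫ x, |u x| ^ (q - 1) :=
    add_nonneg (integral_nonneg fun x => by positivity)
      (mul_nonneg hc.le (integral_nonneg fun x => by positivity))
  calc _ ≤ S * (∫ x, |φ x| ^ q) ^ (2 / q) := by gcongr
    _ ≤ _ := (hSob φ hφc hφs).trans hJ

lemma exists_sq_le_add_rpow {q κ : ℝ} (hq : 2 < q) (hκ : 0 < κ) :
    ∃ C : ℝ, 0 ≤ C ∧ ∀ t : ℝ, 0 ≤ t → t ^ 2 ≤ κ + κ * t ^ q + C * t ^ (q - 1) := by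
  set T : ℝ := κ ^ (-(1 / (q - 2))) with hT
  have hT0 : 0 < T := by positivity
  have hTκ : T ^ (2 - q) = κ := by
    rw [hT, ← Real.rpow_mul hκ.le]
    have : q - 2 ≠ 0 := by linarith
    rw [show -(1 / (q - 2)) * (2 - q) = 1 by field_simp; ring, Real.rpow_one]
  have hα : 0 < √κ := Real.sqrt_pos.2 hκ
  refine ⟨T ^ 2 / √κ ^ (q - 1), by positivity, fun t ht => ?_⟩
  have p1 : 0 ≤ κ * t ^ q := by positivity
  have p2 : 0 ≤ T ^ 2 / √κ ^ (q - 1) * t ^ (q - 1) := by positivity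
  rcases le_total t (√κ) with h | h
  · have : t ^ 2 ≤ √κ ^ 2 := by gcongr
    rw [Real.sq_sqrt hκ.le] at this
    linarith
  have ht0 : 0 < t := hα.trans_le h
  rcases le_total t T with h' | h'
  · have h1 : t ^ 2 ≤ T ^ 2 := by gcongr
    have h2 : √κ ^ (q - 1) ≤ t ^ (q - 1) := by gcongr; linarith
    have h3 : T ^ 2 ≤ T ^ 2 / √κ ^ (q - 1) * t ^ (q - 1) := by
      rw [div_mul_eq_mul_div, le_div_iff₀ (by positivity)]
      gcongr
    linarith
  · have h1 : t ^ (2 - q) ≤ T ^ (2 - q) := Real.rpow_le_rpow_of_nonpos hT0 h' (by linarith)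
    have h2 : t ^ 2 = t ^ (2 - q) * t ^ q := by
      rw [← Real.rpow_add ht0, ← Real.rpow_natCast]; norm_num
    rw [hTκ] at h1
    have h3 : t ^ (2 - q) * t ^ q ≤ κ * t ^ q := by gcongr
    linarith

lemma le_one_add_of_rpow_le {x y r : ℝ} (hx : 0 ≤ x) (hr : 1 / 3 ≤ r) (hy : 0 ≤ y)
    (hy1 : y ≤ 1) (h : (1 + x) ^ r ≤ 1 + y) : x ≤ 7 * y := by
  have h1 : (1 + x) ^ (1 / 3 : ℝ) ≤ 1 + y :=
    (Real.rpow_le_rpow_of_exponent_le (by linarith) hr).trans h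
  have h2 : ((1 + x) ^ (1 / 3 : ℝ)) ^ 3 ≤ (1 + y) ^ 3 := by gcongr
  rw [← Real.rpow_natCast, ← Real.rpow_mul (by linarith)] at h2
  norm_num at h2
  nlinarith [mul_nonneg hy (sub_nonneg.2 hy1), mul_nonneg (mul_nonneg hy hy) (sub_nonneg.2 hy1)]

/-- Near-minimizers of the Sobolev quotient have small `L²` norm. -/
lemma exists_integral_sq_le {n : ℕ} {S q K : ℝ} (hS : 0 < S) (hq : 2 < q) (hq6 : q ≤ 6)
    (hK : 0 < K)
    (hSob : ∀ u : Euc n → ℝ, ContDiff ℝ (⊤ : ℕ∞) u → HasCompactSupport u →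
      S * (∫ x, |u x| ^ q) ^ (2 / q) ≤ ∫ x, ‖fderiv ℝ u x‖ ^ 2)
    {Ω : Set (Euc n)} (hΩ : Bornology.IsBounded Ω) {θ : ℝ} (hθ : 0 < θ) :
    ∃ η : ℝ, 0 < η ∧ ∀ u : Euc n → ℝ, ContDiff ℝ (⊤ : ℕ∞) u → HasCompactSupport u →
      tsupport u ⊆ Ω → K ≤ ∫ x, |u x| ^ q → ∫ x, |u x| ^ q ≤ 2 * K →
      ∫ x, ‖fderiv ℝ u x‖ ^ 2 ≤ (1 + η) * (S * (∫ x, |u x| ^ q) ^ (2 / q)) →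
      ∫ x, u x ^ 2 ≤ θ := by
  have hq0 : 0 < q := by linarith
  obtain ⟨k, hk, hrem⟩ := exists_sobolev_remainder hS.le (by linarith : 1 < q) hSob hΩ
  set M := volume.real Ω with hM
  have hM0 : 0 ≤ M := measureReal_nonneg
  set κ : ℝ := θ / (2 * (M + 2 * K + 1)) with hκ
  have hκ0 : 0 < κ := by positivity
  obtain ⟨C, hC, hpt⟩ := exists_sq_le_add_rpow hq hκ0
  set β : ℝ := θ / (2 * (C + 1)) with hβ
  have hβ0 : 0 < β := by positivity
  set k' : ℝ := k / (S * K ^ (2 / q)) with hk'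
  have hk'0 : 0 ≤ k' := by positivity
  obtain ⟨c, hc0, hc1, hc2⟩ : ∃ c : ℝ, 0 < c ∧ 14 * K * k' * c ≤ β / 2 ∧ k' * c ^ 2 ≤ 1 / 2 := by
    set D : ℝ := 14 * K * k' + k' + 1 with hD
    have hD0 : 0 < D := by positivity
    set c : ℝ := min 1 (min (β / 2) (1 / 2) / D) with hc
    have hc0 : 0 < c := by positivity
    have h1 : c ≤ 1 := min_le_left _ _
    have h2 : c * D ≤ min (β / 2) (1 / 2) := by
      rw [← le_div_iff₀ hD0]; exact min_le_right _ _
    have h3 := h2.trans (min_le_left _ _)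
    have h4 := h2.trans (min_le_right _ _)
    have h5 : 0 ≤ K * k' * c := by positivity
    have h6 : 0 ≤ k' * c := by positivity
    have h7 : c * D = 14 * (K * k' * c) + k' * c + c := by rw [hD]; ring
    refine ⟨c, hc0, by linarith, ?_⟩
    nlinarith
  refine ⟨min (1 / 2) (c * β / (28 * K)), by positivity, ?_⟩
  set η : ℝ := min (1 / 2) (c * β / (28 * K)) with hη
  have hη0 : 0 < η := by positivity
  have hη1 : η ≤ 1 / 2 := min_le_left _ _
  have hη2 : 28 * K * η ≤ c * β := by
    have : η ≤ c * β / (28 * K) := min_le_right _ _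
    rw [le_div_iff₀ (by positivity)] at this
    linarith
  intro u hu hs hΩu hN1 hN2 hD
  set N := ∫ x, |u x| ^ q with hN
  set B := ∫ x, |u x| ^ (q - 1) with hB
  have hN0 : 0 < N := hK.trans_le hN1
  have hB0 : 0 ≤ B := integral_nonneg fun x => by positivity
  have hBβ : B ≤ β := by
    have h1 := (hrem u hu hs hΩu c hc0).trans (add_le_add_left hD _)
    have hNq : 0 < N ^ (2 / q) := by positivity
    have h2 : (N + c * B) ^ (2 / q) = (1 + c * B / N) ^ (2 / q) * N ^ (2 / q) := by
      rw [← Real.mul_rpow (by positivity) hN0.le]; congr 1; field_simp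
    rw [h2] at h1
    have h3 : k * c ^ 2 ≤ k' * c ^ 2 * (S * N ^ (2 / q)) := by
      have : k = k' * (S * K ^ (2 / q)) := by rw [hk']; field_simp
      have h4 : K ^ (2 / q) ≤ N ^ (2 / q) := by gcongr
      calc k * c ^ 2 = k' * c ^ 2 * (S * K ^ (2 / q)) := by rw [this]; ring
        _ ≤ _ := by gcongr
    have h4 : (1 + c * B / N) ^ (2 / q) ≤ 1 + (η + k' * c ^ 2) := by
      have hp : 0 < S * N ^ (2 / q) := by positivity
      refine le_of_mul_le_mul_right ?_ hp
      linarith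
    have h5 := le_one_add_of_rpow_le (by positivity)
      (by rw [div_le_div_iff₀ (by norm_num) hq0]; linarith)
      (by positivity) (by linarith) h4
    rw [div_le_iff₀ hN0] at h5
    have h6 : c * B ≤ 14 * K * (η + k' * c ^ 2) := by
      refine h5.trans ?_
      have : 0 ≤ η + k' * c ^ 2 := by positivity
      nlinarith
    have h7 : c * B ≤ c * β := by nlinarith
    exact le_of_mul_le_mul_left h7 hc0
  have iq := integrable_abs_rpow hu.continuous hs hq0
  have iq1 := integrable_abs_rpow hu.continuous hs (r := q - 1) (by linarith)
  have i2 : Integrable fun x => u x ^ 2 := by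
    have := integrable_abs_rpow hu.continuous hs (r := 2) (by norm_num)
    simpa using this
  have ic : IntegrableOn (fun _ => κ) Ω := integrableOn_const hΩ.measure_lt_top.ne
  have ic1 : IntegrableOn (fun x => κ + κ * |u x| ^ q) Ω := ic.add (iq.integrableOn.const_mul κ)
  have e2 : ∫ x, u x ^ 2 = ∫ x in Ω, u x ^ 2 :=
    (setIntegral_eq_integral_of_forall_compl_eq_zero fun x hx => by
      simp [image_eq_zero_of_notMem_tsupport fun h => hx (hΩu h)]).symm
  have hle : ∫ x in Ω, u x ^ 2 ≤
      ∫ x in Ω, (κ + κ * |u x| ^ q + C * |u x| ^ (q - 1)) := by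
    refine integral_mono i2.integrableOn
      (ic1.add (iq1.integrableOn.const_mul C)) fun x => ?_
    have := hpt |u x| (abs_nonneg _)
    rwa [sq_abs] at this
  rw [integral_add ic1 (iq1.integrableOn.const_mul C),
    integral_add ic (iq.integrableOn.const_mul κ), integral_const_mul, integral_const_mul,
    setIntegral_abs_rpow hΩu hq0, setIntegral_abs_rpow hΩu (by linarith : 0 < q - 1),
    setIntegral_const, smul_eq_mul] at hle
  rw [e2]
  have h1 : κ * (M + 2 * K + 1) = θ / 2 := by rw [hκ]; field_simp
  have h2 : β * (C + 1) = θ / 2 := by rw [hβ]; field_simp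
  have h3 : C * B ≤ C * β := by gcongr
  have h4 : κ * N ≤ κ * (2 * K) := by gcongr
  calc _ ≤ M * κ + κ * N + C * B := hle
    _ ≤ θ := by nlinarith

lemma one_add_mul_add_sq_le_rpow {s y : ℝ} (hs : 1 ≤ s) (hy : -1 < y) (hy1 : y ≤ 1) :
    1 + s * y + (s - 1) / 7 * y ^ 2 ≤ (1 + y) ^ s := by
  have h0 : 0 < 1 + y := by linarith
  set w := √(1 + y) with hw
  have hw0 : 0 < w := Real.sqrt_pos.2 h0
  have hww : w ^ 2 = 1 + y := Real.sq_sqrt h0.le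
  have hlog : 2 * (1 - w⁻¹) ≤ Real.log (1 + y) := by
    rw [← hww, Real.log_pow]
    push_cast
    gcongr
    exact Real.one_sub_inv_le_log_of_pos hw0
  have h1 : y + y ^ 2 / 7 ≤ (1 + y) * Real.log (1 + y) := by
    have h2 : (1 + y) * (2 * (1 - w⁻¹)) ≤ (1 + y) * Real.log (1 + y) := by gcongr
    have h3 : (1 + y) * (2 * (1 - w⁻¹)) = 2 * (w ^ 2 - w) := by rw [← hww]; field_simp
    have hw1 : w ≤ 3 / 2 := by nlinarith
    have h4 : y = w ^ 2 - 1 := by linarith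
    have h5 : (w + 1) ^ 2 ≤ 7 := by nlinarith
    have h6 : y ^ 2 ≤ 7 * (w - 1) ^ 2 := by
      calc y ^ 2 = (w + 1) ^ 2 * (w - 1) ^ 2 := by rw [h4]; ring
        _ ≤ _ := by gcongr
    nlinarith
  have h2 : 1 + (s - 1) * Real.log (1 + y) ≤ (1 + y) ^ (s - 1) := by
    rw [Real.rpow_def_of_pos h0]
    linarith [Real.add_one_le_exp (Real.log (1 + y) * (s - 1))]
  have h3 : (1 + y) ^ s = (1 + y) * (1 + y) ^ (s - 1) := by
    rw [← Real.rpow_one_add' h0.le (by linarith)]; ring_nf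
  rw [h3]
  have h4 : (1 + y) * (1 + (s - 1) * Real.log (1 + y)) ≤ (1 + y) * (1 + y) ^ (s - 1) := by
    gcongr
  nlinarith [mul_le_mul_of_nonneg_left h1 (by linarith : 0 ≤ s - 1)]

lemma contDiff_sqrt_one_add_inner_mul {n : ℕ} {u : Euc n → ℝ} (hu : ContDiff ℝ (⊤ : ℕ∞) u)
    {v : Euc n} (hv : ∀ x ∈ tsupport u, |inner ℝ v x| ≤ 1 / 4) :
    ContDiff ℝ (⊤ : ℕ∞) fun x => √(1 + inner ℝ v x) * u x := by
  rw [contDiff_iff_contDiffAt]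
  intro x
  by_cases hx : x ∈ tsupport u
  · have h1 : 1 + inner ℝ v x ≠ 0 := by linarith [(abs_le.1 (hv x hx)).1]
    have h2 : ContDiffAt ℝ (⊤ : ℕ∞) (fun x => 1 + inner ℝ v x) x :=
      contDiffAt_const.add (contDiffAt_const.inner ℝ contDiffAt_id)
    exact (h2.sqrt h1).mul hu.contDiffAt
  · have h1 := notMem_tsupport_iff_eventuallyEq.1 hx
    have h2 : (fun x => √(1 + inner ℝ v x) * u x) =ᶠ[𝓝 x] fun _ => 0 := by
      filter_upwards [h1] with y hy
      simp [hy]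
    exact contDiffAt_const.congr_of_eventuallyEq h2

lemma norm_fderiv_sqrt_one_add_inner_mul_sq_le {n : ℕ} {u : Euc n → ℝ}
    (hu : ContDiff ℝ (⊤ : ℕ∞) u) {v : Euc n} (hv : ∀ x ∈ tsupport u, |inner ℝ v x| ≤ 1 / 4)
    {κ : ℝ} (hκ : 0 < κ) (x : Euc n) :
    ‖fderiv ℝ (fun x => √(1 + inner ℝ v x) * u x) x‖ ^ 2 ≤
      (1 + κ) * ((1 + inner ℝ v x) * ‖fderiv ℝ u x‖ ^ 2) + (1 + 1 / κ) * ‖v‖ ^ 2 * u x ^ 2 := by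
  by_cases hx : x ∈ tsupport u
  · obtain ⟨hl, -⟩ := abs_le.1 (hv x hx)
    have hpos : 0 < 1 + inner ℝ v x := by linarith
    have hux := ((hu.differentiable (by simp)) x).hasFDerivAt
    have hin : HasFDerivAt (fun x => 1 + inner ℝ v x) (innerSL ℝ v) x :=
      ((innerSL ℝ v).hasFDerivAt).const_add 1
    have h1 : HasFDerivAt (fun x => √(1 + inner ℝ v x) * u x) _ x := (hin.sqrt hpos.ne').mul hux
    set f := √(1 + inner ℝ v x) with hf
    have hf0 : 0 < f := Real.sqrt_pos.2 hpos
    have hff : f ^ 2 = 1 + inner ℝ v x := Real.sq_sqrt hpos.le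
    have hf2 : 1 / 2 ≤ f := by nlinarith
    rw [h1.fderiv, ← hff]
    have e1 : ‖f • fderiv ℝ u x + u x • (1 / (2 * f)) • innerSL ℝ v‖ ≤
        f * ‖fderiv ℝ u x‖ + |u x| * ‖v‖ := by
      refine (norm_add_le _ _).trans ?_
      rw [norm_smul, norm_smul, norm_smul, Real.norm_of_nonneg hf0.le, Real.norm_eq_abs,
        Real.norm_of_nonneg (by positivity : 0 ≤ 1 / (2 * f)), innerSL_apply_norm]
      gcongr
      have : 1 / (2 * f) ≤ 1 := by rw [div_le_one (by positivity)]; linarith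
      exact mul_le_of_le_one_left (norm_nonneg _) this
    refine (pow_le_pow_left₀ (norm_nonneg _) e1 2).trans ?_
    set P := f * ‖fderiv ℝ u x‖ with hP
    set Q := |u x| * ‖v‖ with hQ
    have e2 : (P + Q) ^ 2 ≤ (1 + κ) * P ^ 2 + (1 + 1 / κ) * Q ^ 2 := by
      have : 0 ≤ (κ * P - Q) ^ 2 / κ := by positivity
      have h : (κ * P - Q) ^ 2 / κ = κ * P ^ 2 - 2 * P * Q + 1 / κ * Q ^ 2 := by
        field_simp; ring
      nlinarith
    refine e2.trans_eq ?_
    rw [hP, hQ, mul_pow, mul_pow, sq_abs]; ring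
  · have h1 := notMem_tsupport_iff_eventuallyEq.1 hx
    have h2 : (fun x => √(1 + inner ℝ v x) * u x) =ᶠ[𝓝 x] fun _ => 0 := by
      filter_upwards [h1] with y hy
      simp [hy]
    rw [h2.fderiv_eq, fderiv_eq_zero_of_notMem_tsupport hx, h1.eq_of_nhds]
    simp

lemma rpow_mul_le_integral_sqrt_one_add_inner_mul {n : ℕ} {q : ℝ} (hq : 2 < q) {u : Euc n → ℝ}
    (hu : ContDiff ℝ (⊤ : ℕ∞) u) (hs : HasCompactSupport u)
    {v : Euc n} (hv : ∀ x ∈ tsupport u, |inner ℝ v x| ≤ 1 / 4) {m : ℝ}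
    (hm : m * ∫ x, |u x| ^ q = ∫ x, inner ℝ v x * |u x| ^ q) (hm4 : |m| ≤ 1 / 4) :
    (1 + m) ^ (q / 2) * ((∫ x, |u x| ^ q) +
        (q / 2 - 1) / 14 * ∫ x, (inner ℝ v x - m) ^ 2 * |u x| ^ q) ≤
      ∫ x, |√(1 + inner ℝ v x) * u x| ^ q := by
  have hq0 : 0 < q := by linarith
  obtain ⟨hm1, hm2⟩ := abs_le.1 hm4
  have hm0 : 0 < 1 + m := by linarith
  have hcs := hasCompactSupport_abs_rpow hs hq0
  have hct := continuous_abs_rpow hu.continuous hq0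
  have iq := integrable_abs_rpow hu.continuous hs hq0
  have hinner : Continuous fun x : Euc n => inner ℝ v x := by fun_prop
  have i1 : Integrable fun x => inner ℝ v x * |u x| ^ q :=
    (hinner.mul hct).integrable_of_hasCompactSupport hcs.mul_left
  have i2 : Integrable fun x => (inner ℝ v x - m) ^ 2 * |u x| ^ q :=
    (((hinner.sub continuous_const).pow 2).mul hct).integrable_of_hasCompactSupport hcs.mul_left
  have hwc := contDiff_sqrt_one_add_inner_mul hu hv
  have iw : Integrable fun x => |√(1 + inner ℝ v x) * u x| ^ q :=
    integrable_abs_rpow hwc.continuous hs.mul_left hq0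
  set s := q / 2 with hsq
  have hpt : ∀ x, (1 + m) ^ s * (|u x| ^ q + s / (1 + m) *
      (inner ℝ v x * |u x| ^ q - m * |u x| ^ q) +
      (s - 1) / 14 * ((inner ℝ v x - m) ^ 2 * |u x| ^ q)) ≤ |√(1 + inner ℝ v x) * u x| ^ q := by
    intro x
    by_cases hx : x ∈ tsupport u
    · obtain ⟨hl, hr⟩ := abs_le.1 (hv x hx)
      set h : ℝ := inner ℝ v x with hh
      have hpos : 0 < 1 + h := by linarith
      have e1 : |√(1 + h) * u x| ^ q = (1 + h) ^ s * |u x| ^ q := by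
        rw [abs_mul, Real.mul_rpow (abs_nonneg _) (abs_nonneg _), abs_of_nonneg (Real.sqrt_nonneg _),
          Real.sqrt_eq_rpow, ← Real.rpow_mul hpos.le]
        congr 2; rw [hsq]; ring
      set y := (h - m) / (1 + m) with hy
      have e2 : (1 + h) ^ s = (1 + m) ^ s * (1 + y) ^ s := by
        have hy0 : 1 + y = (1 + h) / (1 + m) := by rw [hy]; field_simp; ring
        rw [hy0, ← Real.mul_rpow hm0.le (by positivity)]
        congr 1; field_simp
      have e3 := one_add_mul_add_sq_le_rpow (s := s) (y := y) (by linarith)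
        (by rw [hy, lt_div_iff₀ hm0]; linarith) (by rw [hy, div_le_one hm0]; linarith)
      have e4 : (h - m) ^ 2 / 2 ≤ y ^ 2 := by
        rw [hy, div_pow]
        gcongr
        nlinarith
      have e5 : 1 + s / (1 + m) * (h - m) + (s - 1) / 14 * (h - m) ^ 2 ≤ (1 + y) ^ s := by
        have : s / (1 + m) * (h - m) = s * y := by rw [hy]; ring
        have h6 := mul_le_mul_of_nonneg_left e4 (by linarith : 0 ≤ (s - 1) / 7)
        rw [this]
        linarith
      rw [e1, e2]
      calc _ = (1 + m) ^ s * (1 + s / (1 + m) * (h - m) + (s - 1) / 14 * (h - m) ^ 2) *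
            |u x| ^ q := by ring
        _ ≤ _ := by gcongr
    · simp [image_eq_zero_of_notMem_tsupport hx, hq0.ne']
  have i3 : Integrable fun x => s / (1 + m) * (inner ℝ v x * |u x| ^ q - m * |u x| ^ q) :=
    (i1.sub (iq.const_mul m)).const_mul (s / (1 + m))
  have iq3 : Integrable fun x => |u x| ^ q +
      s / (1 + m) * (inner ℝ v x * |u x| ^ q - m * |u x| ^ q) := iq.add i3
  have i4 := i2.const_mul ((s - 1) / 14)
  have := integral_mono ((iq3.add i4).const_mul ((1 + m) ^ s)) iw hpt
  have e : ∫ x, (1 + m) ^ s * (|u x| ^ q + s / (1 + m) *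
      (inner ℝ v x * |u x| ^ q - m * |u x| ^ q) +
      (s - 1) / 14 * ((inner ℝ v x - m) ^ 2 * |u x| ^ q)) =
      (1 + m) ^ s * ((∫ x, |u x| ^ q) + s / (1 + m) * ((∫ x, inner ℝ v x * |u x| ^ q) -
        m * ∫ x, |u x| ^ q) + (s - 1) / 14 * ∫ x, (inner ℝ v x - m) ^ 2 * |u x| ^ q) := by
    rw [integral_const_mul, ← integral_const_mul m, ← integral_sub i1 (iq.const_mul m),
      ← integral_const_mul (s / (1 + m)), ← integral_const_mul ((s - 1) / 14),
      ← integral_add iq i3, ← integral_add iq3 i4]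
  refine le_trans (le_of_eq ?_) (e.symm.le.trans this)
  rw [hm, sub_self, mul_zero, add_zero]

/-- The Sobolev inequality for `√(1 + ⟪v, x⟫) u`, with the error terms made explicit. -/
lemma sobolev_localized {n : ℕ} {S q : ℝ} (hS : 0 ≤ S) (hq : 2 < q)
    (hSob : ∀ u : Euc n → ℝ, ContDiff ℝ (⊤ : ℕ∞) u → HasCompactSupport u →
      S * (∫ x, |u x| ^ q) ^ (2 / q) ≤ ∫ x, ‖fderiv ℝ u x‖ ^ 2)
    {u : Euc n → ℝ} (hu : ContDiff ℝ (⊤ : ℕ∞) u) (hs : HasCompactSupport u) (h0 : u ≠ 0)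
    {p₀ : ℝ} (hp₀ : 0 ≤ p₀) {g : Euc n → ℝ} (hg : Continuous g)
    (hgs : ∀ x, x ∉ tsupport u → g x = 0) (hgu : ∀ x, p₀ * ‖fderiv ℝ u x‖ ^ 2 ≤ g x)
    {v : Euc n} (hv : ∀ x ∈ tsupport u, |inner ℝ v x| ≤ 1 / 4) {m : ℝ}
    (hm : m * ∫ x, |u x| ^ q = ∫ x, inner ℝ v x * |u x| ^ q) (hm4 : |m| ≤ 1 / 4)
    {κ : ℝ} (hκ : 0 < κ) :
    p₀ * (S * (∫ x, |u x| ^ q) ^ (2 / q)) * ((1 + m) * (1 + (q / 2 - 1) / 14 *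
        ((∫ x, (inner ℝ v x - m) ^ 2 * |u x| ^ q) / ∫ x, |u x| ^ q)) ^ (2 / q)) ≤
      (∫ x, g x) + (∫ x, inner ℝ v x * g x) +
        (5 / 4 * κ * (∫ x, g x) + p₀ * ((1 + 1 / κ) * ‖v‖ ^ 2 * ∫ x, u x ^ 2)) := by
  have hq0 : 0 < q := by linarith
  have hm0 : 0 < 1 + m := by linarith [(abs_le.1 hm4).1]
  have hN : 0 < ∫ x, |u x| ^ q := integral_abs_rpow_pos hu.continuous hs h0 hq0
  have hVn : 0 ≤ ∫ x, (inner ℝ v x - m) ^ 2 * |u x| ^ q :=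
    integral_nonneg fun x => by positivity
  have h1 := rpow_mul_le_integral_sqrt_one_add_inner_mul hq hu hs hv hm hm4
  have hwc := contDiff_sqrt_one_add_inner_mul hu hv
  have hws : HasCompactSupport fun x => √(1 + inner ℝ v x) * u x := hs.mul_left
  have h2 := hSob _ hwc hws
  set N := ∫ x, |u x| ^ q
  set W := ∫ x, (inner ℝ v x - m) ^ 2 * |u x| ^ q
  have hσ : 0 ≤ (q / 2 - 1) / 14 * (W / N) :=
    mul_nonneg (by linarith) (div_nonneg hVn hN.le)
  have e1 : S * N ^ (2 / q) * ((1 + m) * (1 + (q / 2 - 1) / 14 * (W / N)) ^ (2 / q)) =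
      S * ((1 + m) ^ (q / 2) * (N + (q / 2 - 1) / 14 * W)) ^ (2 / q) := by
    have : N + (q / 2 - 1) / 14 * W = N * (1 + (q / 2 - 1) / 14 * (W / N)) := by field_simp
    rw [this, Real.mul_rpow (by positivity) (by positivity), Real.mul_rpow hN.le (by positivity),
      ← Real.rpow_mul hm0.le, show q / 2 * (2 / q) = 1 by field_simp, Real.rpow_one]
    ring
  have h3 : S * N ^ (2 / q) * ((1 + m) * (1 + (q / 2 - 1) / 14 * (W / N)) ^ (2 / q)) ≤
      ∫ x, ‖fderiv ℝ (fun x => √(1 + inner ℝ v x) * u x) x‖ ^ 2 := by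
    rw [e1]
    refine le_trans ?_ h2
    have hb : 0 ≤ (1 + m) ^ (q / 2) * (N + (q / 2 - 1) / 14 * W) :=
      mul_nonneg (by positivity) (add_nonneg hN.le (mul_nonneg (by linarith) hVn))
    gcongr
  have hgc : HasCompactSupport g := HasCompactSupport.intro hs fun x hx => hgs x hx
  have hinner : Continuous fun x : Euc n => inner ℝ v x := by fun_prop
  have ig : Integrable g := hg.integrable_of_hasCompactSupport hgc
  have ivg : Integrable fun x => inner ℝ v x * g x :=
    (hinner.mul hg).integrable_of_hasCompactSupport hgc.mul_left
  have iu : Integrable fun x => u x ^ 2 := by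
    have := integrable_abs_rpow hu.continuous hs (r := 2) (by norm_num)
    simpa using this
  have hpt : ∀ x, p₀ * ‖fderiv ℝ (fun x => √(1 + inner ℝ v x) * u x) x‖ ^ 2 ≤
      g x + inner ℝ v x * g x + 5 / 4 * κ * g x + p₀ * ((1 + 1 / κ) * ‖v‖ ^ 2) * u x ^ 2 := by
    intro x
    have h4 := mul_le_mul_of_nonneg_left
      (norm_fderiv_sqrt_one_add_inner_mul_sq_le hu hv hκ x) hp₀
    refine h4.trans ?_
    by_cases hx : x ∈ tsupport u
    · obtain ⟨hl, hr⟩ := abs_le.1 (hv x hx)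
      have hg0 : 0 ≤ g x := (mul_nonneg hp₀ (sq_nonneg _)).trans (hgu x)
      have h5 : (1 + inner ℝ v x) * (p₀ * ‖fderiv ℝ u x‖ ^ 2) ≤ (1 + inner ℝ v x) * g x :=
        mul_le_mul_of_nonneg_left (hgu x) (by linarith)
      have h6 : (1 + inner ℝ v x) * g x ≤ 5 / 4 * g x := by gcongr; linarith
      have h7 := mul_le_mul_of_nonneg_left (h5.trans h6) hκ.le
      linarith
    · rw [hgs x hx, fderiv_eq_zero_of_notMem_tsupport hx, image_eq_zero_of_notMem_tsupport hx]
      simp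
  have i1 : Integrable fun x => g x + inner ℝ v x * g x := ig.add ivg
  have i2 : Integrable fun x => g x + inner ℝ v x * g x + 5 / 4 * κ * g x :=
    i1.add (ig.const_mul _)
  have i3 := iu.const_mul (p₀ * ((1 + 1 / κ) * ‖v‖ ^ 2))
  have h5 := integral_mono ((integrable_norm_fderiv_sq hwc hws).const_mul p₀) (i2.add i3) hpt
  rw [integral_const_mul] at h5
  have h6 : ∫ x, (g x + inner ℝ v x * g x + 5 / 4 * κ * g x +
      p₀ * ((1 + 1 / κ) * ‖v‖ ^ 2) * u x ^ 2) = (∫ x, g x) + (∫ x, inner ℝ v x * g x) +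
        (5 / 4 * κ * (∫ x, g x) + p₀ * ((1 + 1 / κ) * ‖v‖ ^ 2 * ∫ x, u x ^ 2)) := by
    rw [integral_add i2 i3, integral_add i1 (ig.const_mul _), integral_add ig ivg,
      integral_const_mul, integral_const_mul]
    ring
  calc _ = p₀ * (S * N ^ (2 / q) * ((1 + m) * (1 + (q / 2 - 1) / 14 * (W / N)) ^ (2 / q))) := by
        ring
    _ ≤ _ := mul_le_mul_of_nonneg_left h3 hp₀
    _ ≤ _ := h5.trans_eq h6

lemma abs_sub_le_and_le_of_localized {K D A H e m x r η ω : ℝ} (hK : 0 < K) (hKD : K ≤ D)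
    (hDA : D ≤ A) (hA : A ≤ K * (1 + η)) (hm : |m| ≤ 1 / 4) (hx : 0 ≤ x) (hr : 1 / 3 ≤ r)
    (hη : η ≤ ω / 2) (he : e ≤ K * (ω / 2)) (hω : 0 < ω) (hω1 : ω ≤ 1)
    (h1 : D * ((1 + m) * (1 + x) ^ r) ≤ A + H + e)
    (h2 : D * ((1 + -m) * (1 + x) ^ r) ≤ A + -H + e) :
    |K * m - H| ≤ 2 * K * ω ∧ x ≤ 7 * ω := by
  obtain ⟨hm1, hm2⟩ := abs_le.1 hm
  have hD0 : 0 < D := hK.trans_le hKD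
  have hX : 1 ≤ (1 + x) ^ r := Real.one_le_rpow (by linarith) (by linarith)
  have hKη : K * η ≤ K * (ω / 2) := by gcongr
  have hAe : A + e ≤ K * (1 + ω) := by linarith
  constructor
  · have h3 : D * (1 + m) ≤ D * ((1 + m) * (1 + x) ^ r) := by
      gcongr; exact le_mul_of_one_le_right (by linarith) hX
    have h4 : D * (1 + -m) ≤ D * ((1 + -m) * (1 + x) ^ r) := by
      gcongr; exact le_mul_of_one_le_right (by linarith) hX
    have h5 : |(D - K) * m| ≤ K * ω := by
      rw [abs_mul, abs_of_nonneg (by linarith)]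
      have : (D - K) * |m| ≤ (K * (ω / 2)) * 1 := by
        gcongr <;> linarith
      have : 0 < K * ω := by positivity
      linarith
    obtain ⟨h6, h7⟩ := abs_le.1 h5
    rw [abs_le]
    constructor <;> linarith
  · have h3 : D * (1 + x) ^ r ≤ A + e := by linarith
    have h4 : K * (1 + x) ^ r ≤ K * (1 + ω) :=
      (mul_le_mul_of_nonneg_right hKD (by linarith)).trans (h3.trans hAe)
    exact le_one_add_of_rpow_le hx hr hω.le hω1 (le_of_mul_le_mul_left h4 hK)

lemma exists_dist_lt_of_sum_variance_lt {n : ℕ} {q : ℝ} (hq : 0 < q) {u : Euc n → ℝ}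
    (hu : Continuous u) (hs : HasCompactSupport u) {W : Set (Euc n)} (hW : tsupport u ⊆ W)
    {b : Euc n} {ρ : ℝ}
    (h : ∑ i, ∫ x, (x i - b i) ^ 2 * |u x| ^ q < ρ ^ 2 * ∫ x, |u x| ^ q) (hρ : 0 < ρ) :
    ∃ x ∈ W, dist x b < ρ := by
  by_contra! hc
  have hct := continuous_abs_rpow hu hq
  have hcs := hasCompactSupport_abs_rpow hs hq
  have hi : ∀ i ∈ Finset.univ, Integrable fun x : Euc n => (x i - b i) ^ 2 * |u x| ^ q := by
    intro i _
    have hc : Continuous fun x : Euc n => (x i - b i) ^ 2 := by fun_prop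
    exact (hc.mul hct).integrable_of_hasCompactSupport hcs.mul_left
  refine h.not_ge ?_
  rw [← integral_finsetSum _ hi, ← integral_const_mul]
  refine integral_mono ((integrable_abs_rpow hu hs hq).const_mul _) (integrable_finsetSum _ hi)
    fun x => ?_
  by_cases hx : x ∈ W
  · have h1 := hc x hx
    have h2 : ρ ^ 2 ≤ ∑ i, (x i - b i) ^ 2 := by
      have h3 : dist x b ^ 2 = ∑ i, (x i - b i) ^ 2 := by
        rw [EuclideanSpace.dist_eq, Real.sq_sqrt (by positivity)]
        simp [Real.dist_eq, sq_abs]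
      rw [← h3]; gcongr
    simp only [← Finset.sum_mul]
    gcongr
  · simp [image_eq_zero_of_notMem_tsupport fun h => hx (hW h), hq.ne']

/-- For a near-minimizer `u` with energy density `g`, the barycenter of `g` is close to `W`. -/
lemma exists_near_minimizer_barycenter {n : ℕ} (hn : 0 < n) {S q : ℝ} (hS : 0 < S) (hq : 2 < q)
    (hq6 : q ≤ 6)
    (hSob : ∀ u : Euc n → ℝ, ContDiff ℝ (⊤ : ℕ∞) u → HasCompactSupport u →
      S * (∫ x, |u x| ^ q) ^ (2 / q) ≤ ∫ x, ‖fderiv ℝ u x‖ ^ 2)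
    {W : Set (Euc n)} (hW : Bornology.IsBounded W) {p₀ K : ℝ} (hp₀ : 0 < p₀) (hK : 0 < K)
    (hKS : p₀ * (S * K ^ (2 / q)) = K) {ρ : ℝ} (hρ : 0 < ρ) :
    ∃ η : ℝ, 0 < η ∧ ∀ u g : Euc n → ℝ, ContDiff ℝ (⊤ : ℕ∞) u → HasCompactSupport u → u ≠ 0 →
      tsupport u ⊆ W → Continuous g → (∀ x, x ∉ tsupport u → g x = 0) →
      (∀ x, p₀ * ‖fderiv ℝ u x‖ ^ 2 ≤ g x) → ∫ x, g x = ∫ x, |u x| ^ q →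
      K ≤ ∫ x, g x → ∫ x, g x ≤ K * (1 + η) →
      ∃ z ∈ W, dist (K⁻¹ • ∫ x, g x • x) z < 2 * ρ := by
  obtain ⟨R, hR, hRW⟩ := hW.exists_pos_norm_le
  set τ : ℝ := 1 / (4 * R) with hτ
  have hτ0 : 0 < τ := by positivity
  have hq0 : 0 < q := by linarith
  have hn0 : (0 : ℝ) < n := by exact_mod_cast hn
  set σ : ℝ := q / 2 - 1 with hσ
  have hσ0 : 0 < σ := by linarith
  obtain ⟨ω, hω0, hω1, hω2, hω3⟩ : ∃ ω : ℝ, 0 < ω ∧ ω ≤ 1 ∧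
      n * (98 * ω) < ρ ^ 2 * (σ * τ ^ 2) ∧ n * (4 * ω) < ρ ^ 2 * τ ^ 2 := by
    refine ⟨min 1 (min (ρ ^ 2 * (σ * τ ^ 2)) (ρ ^ 2 * τ ^ 2) / (100 * n)), by positivity,
      min_le_left _ _, ?_⟩
    set ω := min 1 (min (ρ ^ 2 * (σ * τ ^ 2)) (ρ ^ 2 * τ ^ 2) / (100 * n)) with hω
    have hω0 : 0 < ω := by positivity
    have h1 : ω * (100 * n) ≤ min (ρ ^ 2 * (σ * τ ^ 2)) (ρ ^ 2 * τ ^ 2) := by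
      rw [← le_div_iff₀ (by positivity)]; exact min_le_right _ _
    have h2 := h1.trans (min_le_left _ _)
    have h3 := h1.trans (min_le_right _ _)
    have h4 : 0 < n * ω := by positivity
    constructor <;> linarith
  set κ : ℝ := ω / 10 with hκ
  have hκ0 : 0 < κ := by positivity
  set C : ℝ := p₀ * ((1 + 1 / κ) * τ ^ 2) with hC
  have hC0 : 0 < C := by positivity
  obtain ⟨η₁, hη₁, hsmall⟩ := exists_integral_sq_le hS hq hq6 hK hSob hW
    (θ := K * (ω / 4) / C) (by positivity)
  refine ⟨min η₁ (ω / 2), by positivity, ?_⟩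
  set η := min η₁ (ω / 2) with hη
  have hη0 : 0 < η := by positivity
  intro u g hu hs h0 huW hg hgs hgu hgN hKA hAK
  set N := ∫ x, |u x| ^ q with hN
  rw [hgN] at hKA hAK
  have hN0 : 0 < N := hK.trans_le hKA
  have hηω : η ≤ ω / 2 := min_le_right _ _
  have hA2 : N ≤ 2 * K := by nlinarith
  have hgc : HasCompactSupport g := HasCompactSupport.intro hs fun x hx => hgs x hx
  have ig : Integrable g := hg.integrable_of_hasCompactSupport hgc
  have hgrad : p₀ * ∫ x, ‖fderiv ℝ u x‖ ^ 2 ≤ N := by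
    rw [← hgN, ← integral_const_mul]
    exact integral_mono ((integrable_norm_fderiv_sq hu hs).const_mul _) ig hgu
  set D : ℝ := p₀ * (S * N ^ (2 / q)) with hD
  have hKD : K ≤ D := by
    rw [← hKS, hD]; gcongr
  have hDA : D ≤ N := (mul_le_mul_of_nonneg_left (hSob u hu hs) hp₀.le).trans hgrad
  have hL2 : ∫ x, u x ^ 2 ≤ K * (ω / 4) / C := by
    refine hsmall u hu hs huW hKA hA2 (le_of_mul_le_mul_left (hgrad.trans ?_) hp₀)
    have h1 : K * (1 + η) ≤ D * (1 + η₁) := by gcongr; exact min_le_left _ _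
    calc N ≤ D * (1 + η₁) := hAK.trans h1
      _ = _ := by rw [hD]; ring
  have he : 5 / 4 * κ * N + C * ∫ x, u x ^ 2 ≤ K * (ω / 2) := by
    rw [le_div_iff₀ hC0] at hL2
    have : κ * N ≤ κ * (2 * K) := by gcongr
    have h3 : κ * (2 * K) = K * ω / 5 := by rw [hκ]; ring
    linarith
  have hct := continuous_abs_rpow hu.continuous hq0
  have hcs := hasCompactSupport_abs_rpow hs hq0
  have iq := integrable_abs_rpow hu.continuous hs hq0
  set b : Euc n := WithLp.toLp 2 fun i => (∫ x : Euc n, x i * |u x| ^ q) / N with hb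
  have hbi : ∀ i, b i * N = ∫ x : Euc n, x i * |u x| ^ q := fun i => by
    simp only [hb]; field_simp
  set F : Euc n := K⁻¹ • ∫ x, g x • x with hF
  have igx : Integrable fun x : Euc n => g x • x :=
    (hg.smul continuous_id).integrable_of_hasCompactSupport hgc.smul_right
  have hFi : ∀ i, K * F i = ∫ x : Euc n, x i * g x := fun i => by
    have h1 : ∫ x : Euc n, g x * x i = (∫ x : Euc n, g x • x) i :=
      (EuclideanSpace.proj (𝕜 := ℝ) i : Euc n →L[ℝ] ℝ).integral_comp_comm igx
    rw [hF, PiLp.smul_apply, smul_eq_mul, ← h1, mul_inv_cancel_left₀ hK.ne']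
    simp_rw [mul_comm]
  have key : ∀ i, |b i - F i| * τ ≤ 2 * ω ∧
      (∫ x : Euc n, (x i - b i) ^ 2 * |u x| ^ q) * (σ * τ ^ 2) ≤ 98 * ω * N := by
    intro i
    have hinn : ∀ (t : ℝ) (x : Euc n), inner ℝ (EuclideanSpace.single i t) x = t * x i :=
      fun t x => by simp [EuclideanSpace.inner_single_left]
    have hτx : ∀ x ∈ tsupport u, |τ * x i| ≤ 1 / 4 := by
      intro x hx
      have h1 : |x i| ≤ R := (PiLp.norm_apply_le x i).trans (hRW x (huW hx))
      rw [abs_mul, abs_of_pos hτ0]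
      calc τ * |x i| ≤ τ * R := by gcongr
        _ = 1 / 4 := by rw [hτ]; field_simp
    have hm4 : |τ * b i| ≤ 1 / 4 := by
      have h1 : |τ * b i| * N ≤ 1 / 4 * N := by
        calc |τ * b i| * N = ‖∫ x : Euc n, τ * x i * |u x| ^ q‖ := by
              simp_rw [mul_assoc]
              rw [integral_const_mul, ← hbi, Real.norm_eq_abs, ← mul_assoc, abs_mul _ N,
                abs_of_pos hN0]
          _ ≤ ∫ x : Euc n, 1 / 4 * |u x| ^ q := by
              refine norm_integral_le_of_norm_le (iq.const_mul _) (ae_of_all _ fun x => ?_)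
              by_cases hx : x ∈ tsupport u
              · rw [norm_mul, Real.norm_eq_abs, Real.norm_of_nonneg (by positivity)]
                gcongr
                exact hτx x hx
              · simp [image_eq_zero_of_notMem_tsupport hx, hq0.ne']
          _ = _ := integral_const_mul _ _
      exact le_of_mul_le_mul_right h1 hN0
    have hloc : ∀ t : ℝ, |t| = τ → D * ((1 + t * b i) * (1 + σ / 14 *
        (τ ^ 2 * (∫ x : Euc n, (x i - b i) ^ 2 * |u x| ^ q) / N)) ^ (2 / q)) ≤
        N + t * (K * F i) + (5 / 4 * κ * N + C * ∫ x, u x ^ 2) := by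
      intro t ht
      have hv : ∀ x ∈ tsupport u, |inner ℝ (EuclideanSpace.single i t) x| ≤ 1 / 4 := by
        intro x hx
        rw [hinn, abs_mul, ht, ← abs_of_pos hτ0, ← abs_mul]
        exact hτx x hx
      have hm : t * b i * ∫ x, |u x| ^ q =
          ∫ x, inner ℝ (EuclideanSpace.single i t) x * |u x| ^ q := by
        simp_rw [hinn, mul_assoc]
        rw [integral_const_mul, ← hbi]
      have hm4' : |t * b i| ≤ 1 / 4 := by
        rwa [abs_mul, ht, ← abs_of_pos hτ0, ← abs_mul]
      have h1 := sobolev_localized hS.le hq hSob hu hs h0 hp₀.le hg hgs hgu hv hm hm4' hκ0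
      have ht2 : t ^ 2 = τ ^ 2 := by rw [← sq_abs, ht]
      have e1 : ∀ x : Euc n, (t * x i - t * b i) ^ 2 * |u x| ^ q =
          τ ^ 2 * ((x i - b i) ^ 2 * |u x| ^ q) := fun x => by rw [← ht2]; ring
      simp_rw [hinn, e1, mul_assoc t] at h1
      rw [integral_const_mul, integral_const_mul, ← hFi, hgN, PiLp.norm_single,
        Real.norm_eq_abs, ht] at h1
      refine h1.trans_eq ?_
      rw [hC]; ring
    have hV0 : 0 ≤ ∫ x : Euc n, (x i - b i) ^ 2 * |u x| ^ q :=
      integral_nonneg fun x => by positivity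
    have h1 := hloc τ (abs_of_pos hτ0)
    have h2 := hloc (-τ) (by rw [abs_neg, abs_of_pos hτ0])
    rw [neg_mul, neg_mul] at h2
    obtain ⟨h3, h4⟩ := abs_sub_le_and_le_of_localized hK hKD hDA hAK hm4 (by positivity)
      (by rw [div_le_div_iff₀ (by norm_num) hq0]; linarith) hηω he hω0 hω1 h1 h2
    constructor
    · have h5 : K * (τ * b i) - τ * (K * F i) = K * τ * (b i - F i) := by ring
      rw [h5, abs_mul, abs_of_pos (by positivity)] at h3
      refine le_of_mul_le_mul_left ?_ hK
      linarith
    · have h5 : σ / 14 * (τ ^ 2 * (∫ x : Euc n, (x i - b i) ^ 2 * |u x| ^ q) / N) =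
        (∫ x : Euc n, (x i - b i) ^ 2 * |u x| ^ q) * (σ * τ ^ 2) / (14 * N) := by field_simp
      rw [h5, div_le_iff₀ (by positivity)] at h4
      linarith
  have hvar : ∑ i, ∫ x : Euc n, (x i - b i) ^ 2 * |u x| ^ q < ρ ^ 2 * N := by
    have h1 : (∑ i, ∫ x : Euc n, (x i - b i) ^ 2 * |u x| ^ q) * (σ * τ ^ 2) ≤
        n * (98 * ω) * N := by
      rw [Finset.sum_mul]
      refine (Finset.sum_le_sum fun i _ => (key i).2).trans_eq ?_
      simp; ring
    have h2 : n * (98 * ω) * N < ρ ^ 2 * (σ * τ ^ 2) * N := by gcongr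
    refine lt_of_mul_lt_mul_right (h1.trans_lt (h2.trans_eq ?_)) (by positivity : 0 ≤ σ * τ ^ 2)
    ring
  obtain ⟨z, hz, hzb⟩ := exists_dist_lt_of_sum_variance_lt hq0 hu.continuous hs huW hvar hρ
  refine ⟨z, hz, ?_⟩
  have hbF : dist F b < ρ := by
    rw [dist_comm, EuclideanSpace.dist_eq, Real.sqrt_lt' hρ]
    have h1 : ∀ i, dist (b i) (F i) ^ 2 * τ ^ 2 ≤ 4 * ω := fun i => by
      rw [Real.dist_eq, ← mul_pow]
      have := pow_le_pow_left₀ (by positivity) (key i).1 2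
      nlinarith
    have h2 : (∑ i, dist (b i) (F i) ^ 2) * τ ^ 2 ≤ n * (4 * ω) := by
      rw [Finset.sum_mul]
      refine (Finset.sum_le_sum fun i _ => h1 i).trans_eq ?_
      simp
    exact lt_of_mul_lt_mul_right (h2.trans_lt hω3) (by positivity)
  calc dist F z ≤ dist F b + dist b z := dist_triangle _ _ _
    _ < 2 * ρ := by rw [dist_comm b z]; linarith

lemma continuous_mul_norm_fderiv_sq {n : ℕ} {u p : Euc n → ℝ} (hu : ContDiff ℝ (⊤ : ℕ∞) u)
    (hp : ∀ x ∈ tsupport u, ContinuousAt p x) :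
    Continuous fun x => p x * ‖fderiv ℝ u x‖ ^ 2 := by
  rw [continuous_iff_continuousAt]
  intro x
  by_cases hx : x ∈ tsupport u
  · exact (hp x hx).mul (continuous_norm_fderiv_sq hu).continuousAt
  · have h : (fun x => p x * ‖fderiv ℝ u x‖ ^ 2) =ᶠ[𝓝 x] fun _ => 0 := by
      filter_upwards [(isClosed_tsupport u).isOpen_compl.mem_nhds hx] with y hy
      simp [fderiv_eq_zero_of_notMem_tsupport hy]
    exact continuousAt_const.congr h.symm

theorem stmt_17 {n : ℕ} (hn : 3 ≤ n)
    (Ω : Set (Euc n)) (hΩo : IsOpen Ω) (hΩb : Bornology.IsBounded Ω)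
    (a : Euc n) (ha : a ∈ Ω)
    (p : Euc n → ℝ) (hpc : ContinuousOn p (closure Ω))
    (p₀ : ℝ) (hp₀ : 0 < p₀) (hpa : p a = p₀) (hmin : ∀ x ∈ closure Ω, p₀ ≤ p x)
    (q : ℝ) (hq : q = 2 * (n : ℝ) / ((n : ℝ) - 2))
    (ε : ℝ) (hε : 0 < ε) (hball : Metric.closedBall a ε ⊆ Ω)
    (V : Set (Euc n)) (hVo : IsOpen V)
    (hV : closure (Ω \ Metric.closedBall a ε) ⊆ V) :
    ∃ η : ℝ, 0 < η ∧ ∀ u : Euc n → ℝ, IsTest (Ω \ Metric.closedBall a ε) u →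
      (∫ x in Ω \ Metric.closedBall a ε, p x * ‖gradient u x‖ ^ 2) -
          (∫ x in Ω \ Metric.closedBall a ε, |u x| ^ q) = 0 →
      (1 / 2) * (∫ x in Ω \ Metric.closedBall a ε, p x * ‖gradient u x‖ ^ 2) -
          (1 / q) * (∫ x in Ω \ Metric.closedBall a ε, |u x| ^ q) ≤
        (1 / (n : ℝ)) * (p₀ * SobolevS Ω q) ^ ((n : ℝ) / 2) + 2 * η →
      ((p₀ * SobolevS Ω q) ^ (-(n : ℝ) / 2)) •
          (∫ x in Ω \ Metric.closedBall a ε, (p x * ‖gradient u x‖ ^ 2) • x) ∈ V := by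
  have hn' : (3 : ℝ) ≤ n := by exact_mod_cast hn
  have hn2 : (0 : ℝ) < n - 2 := by linarith
  have hq2 : 2 < q := by rw [hq, lt_div_iff₀ hn2]; linarith
  have hq6 : q ≤ 6 := by rw [hq, div_le_iff₀ hn2]; linarith
  have hq0 : 0 < q := by linarith
  set W := Ω \ Metric.closedBall a ε with hWdef
  have hWΩ : W ⊆ Ω := Set.sdiff_subset
  set S := SobolevS Ω q with hSdef
  have hS : 0 < S := sobolevS_pos hn hq hΩo ha
  have hSob := fun u hu hs =>
    sobolevS_mul_le_of_hasCompactSupport hn hq hΩo ha (u := u) hu hs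
  set K : ℝ := (p₀ * S) ^ ((n : ℝ) / 2) with hK
  have hpS : 0 < p₀ * S := by positivity
  have hK0 : 0 < K := by positivity
  have hKq : K ^ (1 - 2 / q) = p₀ * S := by
    rw [hK, ← Real.rpow_mul hpS.le]
    have : (n : ℝ) / 2 * (1 - 2 / q) = 1 := by rw [hq]; field_simp; ring
    rw [this, Real.rpow_one]
  have hKS : p₀ * (S * K ^ (2 / q)) = K := by
    rw [← mul_assoc, ← hKq, ← Real.rpow_add hK0]; simp
  obtain ⟨δ, hδ, hδV⟩ := (hΩb.subset hWΩ).isCompact_closure.exists_thickening_subset_open hVo hV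
  obtain ⟨η, hη, hmain⟩ := exists_near_minimizer_barycenter (by omega) hS hq2 hq6 hSob
    (hΩb.subset hWΩ) hp₀ hK0 hKS (half_pos hδ)
  refine ⟨K * η / (2 * n), by positivity, ?_⟩
  rintro u ⟨hu, hs, huW, h0⟩ hΓ hE
  set g : Euc n → ℝ := fun x => p x * ‖fderiv ℝ u x‖ ^ 2 with hg
  have hgs : ∀ x, x ∉ tsupport u → g x = 0 := fun x hx => by
    simp [hg, fderiv_eq_zero_of_notMem_tsupport hx]
  have hgu : ∀ x, p₀ * ‖fderiv ℝ u x‖ ^ 2 ≤ g x := by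
    intro x
    by_cases hx : x ∈ tsupport u
    · have := hmin x (subset_closure (hWΩ (huW hx)))
      simp only [hg]; gcongr
    · simp [hg, fderiv_eq_zero_of_notMem_tsupport hx]
  have hgc : Continuous g := continuous_mul_norm_fderiv_sq hu fun x hx =>
    hpc.continuousAt (mem_of_superset (hΩo.mem_nhds (hWΩ (huW hx))) subset_closure)
  have ig : Integrable g :=
    hgc.integrable_of_hasCompactSupport (HasCompactSupport.intro hs fun x hx => hgs x hx)
  have e1 : ∫ x in W, p x * ‖gradient u x‖ ^ 2 = ∫ x, g x := by
    simp_rw [norm_gradient_eq]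
    exact setIntegral_eq_integral_of_forall_compl_eq_zero fun x hx => hgs x fun h => hx (huW h)
  have e2 : ∫ x in W, (p x * ‖gradient u x‖ ^ 2) • x = ∫ x, g x • x := by
    simp_rw [norm_gradient_eq]
    refine setIntegral_eq_integral_of_forall_compl_eq_zero fun x hx => ?_
    have : g x = 0 := hgs x fun h => hx (huW h)
    simp only [hg] at this
    rw [this, zero_smul]
  rw [e1, setIntegral_abs_rpow huW hq0] at hΓ hE
  rw [e2, neg_div, Real.rpow_neg hpS.le, ← hK]
  have hgN : ∫ x, g x = ∫ x, |u x| ^ q := sub_eq_zero.1 hΓ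
  have hN0 := integral_abs_rpow_pos hu.continuous hs h0 hq0
  rw [← hgN] at hE hN0
  have hgrad : p₀ * ∫ x, ‖fderiv ℝ u x‖ ^ 2 ≤ ∫ x, g x := by
    rw [← integral_const_mul]
    exact integral_mono ((integrable_norm_fderiv_sq hu hs).const_mul _) ig hgu
  have hlow : K ≤ ∫ x, g x := by
    have h1 := (mul_le_mul_of_nonneg_left (hSob u hu hs) hp₀.le).trans hgrad
    rw [← hgN, ← mul_assoc, ← hKq, ← le_div_iff₀ (by positivity)] at h1
    have h2 : (∫ x, g x) / (∫ x, g x) ^ (2 / q) = (∫ x, g x) ^ (1 - 2 / q) := by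
      rw [Real.rpow_sub hN0, Real.rpow_one]
    rw [h2] at h1
    refine (Real.rpow_le_rpow_iff hK0.le hN0.le ?_).1 h1
    rw [sub_pos, div_lt_one hq0]
    exact hq2
  have hup : ∫ x, g x ≤ K * (1 + η) := by
    have h1 : 1 / 2 - 1 / q = 1 / n := by rw [hq]; field_simp; ring
    rw [← sub_mul, h1] at hE
    have h2 : 1 / (n : ℝ) * K + 2 * (K * η / (2 * n)) = 1 / n * (K * (1 + η)) := by
      field_simp
    rw [h2] at hE
    exact le_of_mul_le_mul_left hE (by positivity)
  obtain ⟨z, hz, hzF⟩ := hmain u g hu hs h0 huW hgc hgs hgu hgN hlow hup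
  refine hδV (Metric.mem_thickening_iff.2 ⟨z, subset_closure hz, ?_⟩)
  linarith
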